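/- arXiv:2602.12424 — 3 statements merged into one kernel-verified Lean document; each statement's English description precedes it below -/
import Mathlib

section
/- Under the RankLLM setup, the Jacobi (combined-chain) update map J, sending (x, y) ∈ ℝ^Q × ℝ^M to (x'', y'') with x'' q = α Σ_m P_{M→Q} m q * y m + (1−α)/Q and y'' m = α Σ_q P_{Q→M} q m * x q + (1−α)/M, is an α-contraction in the combined ℓ¹ distance: for all pairs (x₁,y₁), (x₂,y₂) ∈ ℝ^Q × ℝ^M, d(J(x₁,y₁), J(x₂,y₂)) ≤ α · d((x₁,y₁),(x₂,y₂)), where d((x,y),(x',y')) = Σ_q |x q − x' q| + Σ_m |y m − y' m|. -/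
/-- Competency transition matrix: `P_{Q→M} q m = A q m / S(q)` with `S(q) = Σ_m A q m`. -/
noncomputable def PQM {Q M : ℕ} (A : Fin Q → Fin M → ℝ) : Fin Q → Fin M → ℝ :=
  fun q m => A q m / ∑ m', A q m'

/-- Difficulty transition matrix: `P_{M→Q} m q = (1 - A q m) / F(m)` with
`F(m) = Σ_q (1 - A q m)`. -/
noncomputable def PMQ {Q M : ℕ} (A : Fin Q → Fin M → ℝ) : Fin M → Fin Q → ℝ :=
  fun m q => (1 - A q m) / ∑ q', (1 - A q' m)

/-- Jacobi (combined-chain) update. -/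
noncomputable def jacobiUpdate {Q M : ℕ} (A : Fin Q → Fin M → ℝ) (α : ℝ) :
    (Fin Q → ℝ) × (Fin M → ℝ) → (Fin Q → ℝ) × (Fin M → ℝ) :=
  fun p =>
    (fun q => α * ∑ m, PMQ A m q * p.2 m + (1 - α) / (Q : ℝ),
     fun m => α * ∑ q, PQM A q m * p.1 q + (1 - α) / (M : ℝ))

/-- Combined ℓ¹ distance on pairs. -/
noncomputable def pairDist {Q M : ℕ} (p p' : (Fin Q → ℝ) × (Fin M → ℝ)) : ℝ :=
  (∑ q, |p.1 q - p'.1 q|) + ∑ m, |p.2 m - p'.2 m|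

theorem sum_abs_sum_mul_le_of_rows_sum_one {ι κ : Type*} [Fintype ι] [Fintype κ]
    (P : ι → κ → ℝ) (hP : ∀ i j, 0 ≤ P i j) (hrow : ∀ i, ∑ j, P i j = 1) (v : ι → ℝ) :
    ∑ j, |∑ i, P i j * v i| ≤ ∑ i, |v i| :=
  calc
    ∑ j, |∑ i, P i j * v i| ≤ ∑ j, ∑ i, |P i j * v i| :=
      Finset.sum_le_sum fun _ _ => Finset.abs_sum_le_sum_abs _ _
    _ = ∑ i, ∑ j, P i j * |v i| := by
      rw [Finset.sum_comm]
      simp only [abs_mul, abs_of_nonneg (hP _ _)]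
    _ = ∑ i, |v i| := by
      simp only [← Finset.sum_mul, hrow, one_mul]

theorem sum_abs_affine_sub_le {ι κ : Type*} [Fintype ι] [Fintype κ]
    (P : ι → κ → ℝ) (hP : ∀ i j, 0 ≤ P i j) (hrow : ∀ i, ∑ j, P i j = 1)
    {α : ℝ} (hα : 0 ≤ α) (c : ℝ) (v w : ι → ℝ) :
    ∑ j, |(α * ∑ i, P i j * v i + c) - (α * ∑ i, P i j * w i + c)| ≤
      α * ∑ i, |v i - w i| := by
  have h (j : κ) : |(α * ∑ i, P i j * v i + c) - (α * ∑ i, P i j * w i + c)| =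
      α * |∑ i, P i j * (v i - w i)| := by
    simp only [add_sub_add_right_eq_sub, ← mul_sub, ← Finset.sum_sub_distrib, abs_mul,
      abs_of_nonneg hα]
  simp only [h, ← Finset.mul_sum]
  exact mul_le_mul_of_nonneg_left
    (sum_abs_sum_mul_le_of_rows_sum_one P hP hrow fun i => v i - w i) hα

theorem stmt4 (Q M : ℕ) (hQ : 0 < Q) (hM : 0 < M)
    (A : Fin Q → Fin M → ℝ)
    (hA0 : ∀ q m, 0 ≤ A q m) (hA1 : ∀ q m, A q m ≤ 1)
    (hS : ∀ q, 0 < ∑ m, A q m) (hF : ∀ m, 0 < ∑ q, (1 - A q m))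
    (α : ℝ) (hα0 : 0 < α) (hα1 : α < 1)
    (x₁ x₂ : Fin Q → ℝ) (y₁ y₂ : Fin M → ℝ) :
    pairDist (jacobiUpdate A α (x₁, y₁)) (jacobiUpdate A α (x₂, y₂)) ≤
      α * pairDist (Q := Q) (M := M) (x₁, y₁) (x₂, y₂) := by
  have hx := sum_abs_affine_sub_le (PQM A) (fun q m => div_nonneg (hA0 q m) (hS q).le)
    (fun q => by simp only [PQM, ← Finset.sum_div, div_self (hS q).ne'])
    hα0.le ((1 - α) / M) x₁ x₂
  have hy := sum_abs_affine_sub_le (PMQ A)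
    (fun m q => div_nonneg (sub_nonneg.2 (hA1 q m)) (hF m).le)
    (fun m => by simp only [PMQ, ← Finset.sum_div, div_self (hF m).ne'])
    hα0.le ((1 - α) / Q) y₁ y₂
  simp only [pairDist, jacobiUpdate]
  linarith
end

section
/- Under the RankLLM setup, the Gauss–Seidel composed update on the model-score vector, G : ℝ^M → ℝ^M defined by G(y) m = α Σ_q P_{Q→M} q m * (α Σ_{m'} P_{M→Q} m' q * y m' + (1−α)/Q) + (1−α)/M, is an α²-contraction in ℓ¹ norm: for all y₁, y₂ ∈ ℝ^M, Σ_m |G(y₁) m − G(y₂) m| ≤ α² · Σ_m |y₁ m − y₂ m|. -/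
/-- Gauss–Seidel composed update on the model-score vector. -/
noncomputable def gsG {Q M : ℕ} (A : Fin Q → Fin M → ℝ) (α : ℝ) :
    (Fin M → ℝ) → Fin M → ℝ :=
  fun y m => α * ∑ q, PQM A q m *
      (α * ∑ m', PMQ A m' q * y m' + (1 - α) / (Q : ℝ)) + (1 - α) / (M : ℝ)

/-- Pushing a vector forward along a row-stochastic matrix does not increase its `ℓ¹` norm. -/
theorem sum_abs_sum_mul_le_of_stochastic {ι κ : Type*} [Fintype ι] [Fintype κ]
    (P : ι → κ → ℝ) (hP : ∀ i j, 0 ≤ P i j) (hP1 : ∀ i, ∑ j, P i j = 1) (x : ι → ℝ) :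
    ∑ j, |∑ i, P i j * x i| ≤ ∑ i, |x i| :=
  calc ∑ j, |∑ i, P i j * x i|
      ≤ ∑ j, ∑ i, P i j * |x i| := by
        refine Finset.sum_le_sum fun j _ => (Finset.abs_sum_le_sum_abs _ _).trans_eq ?_
        exact Finset.sum_congr rfl fun i _ => by rw [abs_mul, abs_of_nonneg (hP i j)]
    _ = ∑ i, |x i| := by
        rw [Finset.sum_comm]
        exact Finset.sum_congr rfl fun i _ => by rw [← Finset.sum_mul, hP1, one_mul]

/-- The affine terms cancel in a difference of Gauss–Seidel updates. -/
theorem gsG_sub_gsG {Q M : ℕ} (A : Fin Q → Fin M → ℝ) (α : ℝ) (y₁ y₂ : Fin M → ℝ) (m : Fin M) :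
    gsG A α y₁ m - gsG A α y₂ m =
      α ^ 2 * ∑ q, PQM A q m * ∑ m', PMQ A m' q * (y₁ m' - y₂ m') := by
  simp only [gsG, mul_sub, Finset.sum_sub_distrib, mul_add, Finset.sum_add_distrib,
    mul_left_comm _ α, ← Finset.mul_sum]
  ring

theorem stmt5 (Q M : ℕ) (hQ : 0 < Q) (hM : 0 < M)
    (A : Fin Q → Fin M → ℝ)
    (hA0 : ∀ q m, 0 ≤ A q m) (hA1 : ∀ q m, A q m ≤ 1)
    (hS : ∀ q, 0 < ∑ m, A q m) (hF : ∀ m, 0 < ∑ q, (1 - A q m))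
    (α : ℝ) (hα0 : 0 < α) (hα1 : α < 1)
    (y₁ y₂ : Fin M → ℝ) :
    ∑ m, |gsG A α y₁ m - gsG A α y₂ m| ≤ α ^ 2 * ∑ m, |y₁ m - y₂ m| := by
  have hPQM : ∀ q m, 0 ≤ PQM A q m := fun q m => div_nonneg (hA0 q m) (hS q).le
  have hPQM1 : ∀ q, ∑ m, PQM A q m = 1 := fun q => by
    simp only [PQM, ← Finset.sum_div]
    exact div_self (hS q).ne'
  have hPMQ : ∀ m q, 0 ≤ PMQ A m q := fun m q =>
    div_nonneg (sub_nonneg.2 (hA1 q m)) (hF m).le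
  have hPMQ1 : ∀ m, ∑ q, PMQ A m q = 1 := fun m => by
    simp only [PMQ, ← Finset.sum_div]
    exact div_self (hF m).ne'
  simp only [gsG_sub_gsG, abs_mul, abs_of_nonneg (sq_nonneg α), ← Finset.mul_sum]
  refine mul_le_mul_of_nonneg_left ?_ (sq_nonneg α)
  exact (sum_abs_sum_mul_le_of_stochastic (PQM A) hPQM hPQM1 _).trans
    (sum_abs_sum_mul_le_of_stochastic (PMQ A) hPMQ hPMQ1 _)
end

section
/- Under the RankLLM setup, let J be the Jacobi (combined-chain) update on ℝ^Q × ℝ^M and define the successive-difference quantity Δ^{(t)} = d(J^[t](x⁰,y⁰), J^[t−1](x⁰,y⁰)) for t ≥ 1, where d is the combined ℓ¹ distance. Then Δ^{(t+1)} ≤ α · Δ^{(t)} for every t ≥ 1, and consequently Δ^{(t)} ≤ α^{t−1} · Δ^{(1)} for every t ≥ 1. -/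
/-- A nonnegative row-stochastic kernel, acting on row vectors, does not increase the `ℓ¹` norm. -/
theorem sum_abs_sum_mul_le_of_rowStochastic {ι κ : Type*} [Fintype ι] [Fintype κ]
    (P : ι → κ → ℝ) (hP : ∀ i j, 0 ≤ P i j) (hsum : ∀ i, ∑ j, P i j = 1) (v : ι → ℝ) :
    ∑ j, |∑ i, P i j * v i| ≤ ∑ i, |v i| := by
  calc ∑ j, |∑ i, P i j * v i| ≤ ∑ j, ∑ i, P i j * |v i| := by
        refine Finset.sum_le_sum fun j _ => (Finset.abs_sum_le_sum_abs _ _).trans_eq ?_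
        exact Finset.sum_congr rfl fun i _ => by rw [abs_mul, abs_of_nonneg (hP i j)]
    _ = ∑ i, |v i| := by
        rw [Finset.sum_comm]
        exact Finset.sum_congr rfl fun i _ => by rw [← Finset.sum_mul, hsum, one_mul]

/-- A damped affine update driven by a row-stochastic kernel contracts the `ℓ¹` distance by the
damping factor. -/
theorem sum_abs_damped_sub_le {ι κ : Type*} [Fintype ι] [Fintype κ]
    (P : ι → κ → ℝ) (hP : ∀ i j, 0 ≤ P i j) (hsum : ∀ i, ∑ j, P i j = 1)
    {α : ℝ} (hα : 0 ≤ α) (c : ℝ) (v w : ι → ℝ) :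
    ∑ j, |(α * ∑ i, P i j * v i + c) - (α * ∑ i, P i j * w i + c)| ≤ α * ∑ i, |v i - w i| := by
  have h : ∀ j, |(α * ∑ i, P i j * v i + c) - (α * ∑ i, P i j * w i + c)| =
      α * |∑ i, P i j * (v i - w i)| := fun j => by
    rw [add_sub_add_right_eq_sub, ← mul_sub, ← Finset.sum_sub_distrib, abs_mul, abs_of_nonneg hα]
    simp only [mul_sub]
  simp only [h, ← Finset.mul_sum]
  exact mul_le_mul_of_nonneg_left
    (sum_abs_sum_mul_le_of_rowStochastic P hP hsum fun i => v i - w i) hα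

/-- The Jacobi update is an `α`-contraction for the combined `ℓ¹` distance. -/
theorem pairDist_jacobiUpdate_le {Q M : ℕ} {A : Fin Q → Fin M → ℝ}
    (hA0 : ∀ q m, 0 ≤ A q m) (hA1 : ∀ q m, A q m ≤ 1)
    (hS : ∀ q, 0 < ∑ m, A q m) (hF : ∀ m, 0 < ∑ q, (1 - A q m))
    {α : ℝ} (hα : 0 ≤ α) (p p' : (Fin Q → ℝ) × (Fin M → ℝ)) :
    pairDist (jacobiUpdate A α p) (jacobiUpdate A α p') ≤ α * pairDist p p' := by
  have hx := sum_abs_damped_sub_le (PMQ A)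
    (fun m q => div_nonneg (sub_nonneg.2 (hA1 q m)) (hF m).le)
    (fun m => by simp only [PMQ, ← Finset.sum_div]; exact div_self (hF m).ne')
    hα ((1 - α) / (Q : ℝ)) p.2 p'.2
  have hy := sum_abs_damped_sub_le (PQM A)
    (fun q m => div_nonneg (hA0 q m) (hS q).le)
    (fun q => by simp only [PQM, ← Finset.sum_div]; exact div_self (hS q).ne')
    hα ((1 - α) / (M : ℝ)) p.1 p'.1
  calc pairDist (jacobiUpdate A α p) (jacobiUpdate A α p')
      ≤ α * ∑ m, |p.2 m - p'.2 m| + α * ∑ q, |p.1 q - p'.1 q| := add_le_add hx hy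
    _ = α * pairDist p p' := by rw [pairDist]; ring

theorem stmt12 (Q M : ℕ) (hQ : 0 < Q) (hM : 0 < M)
    (A : Fin Q → Fin M → ℝ)
    (hA0 : ∀ q m, 0 ≤ A q m) (hA1 : ∀ q m, A q m ≤ 1)
    (hS : ∀ q, 0 < ∑ m, A q m) (hF : ∀ m, 0 < ∑ q, (1 - A q m))
    (α : ℝ) (hα0 : 0 < α) (hα1 : α < 1)
    (x0 : Fin Q → ℝ) (y0 : Fin M → ℝ) :
    (∀ t : ℕ, 1 ≤ t →
      pairDist ((jacobiUpdate A α)^[t + 1] (x0, y0)) ((jacobiUpdate A α)^[t] (x0, y0)) ≤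
        α * pairDist ((jacobiUpdate A α)^[t] (x0, y0)) ((jacobiUpdate A α)^[t - 1] (x0, y0))) ∧
    (∀ t : ℕ, 1 ≤ t →
      pairDist ((jacobiUpdate A α)^[t] (x0, y0)) ((jacobiUpdate A α)^[t - 1] (x0, y0)) ≤
        α ^ (t - 1) *
          pairDist ((jacobiUpdate A α)^[1] (x0, y0)) ((jacobiUpdate A α)^[0] (x0, y0))) := by
  have step : ∀ n : ℕ,
      pairDist ((jacobiUpdate A α)^[n + 2] (x0, y0)) ((jacobiUpdate A α)^[n + 1] (x0, y0)) ≤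
        α * pairDist ((jacobiUpdate A α)^[n + 1] (x0, y0)) ((jacobiUpdate A α)^[n] (x0, y0)) := by
    intro n
    rw [Function.iterate_succ_apply' _ (n + 1), Function.iterate_succ_apply' _ n]
    exact pairDist_jacobiUpdate_le hA0 hA1 hS hF hα0.le _ _
  refine ⟨fun t ht => ?_, fun t ht => ?_⟩
  · obtain ⟨n, rfl⟩ := Nat.exists_eq_add_of_le' ht
    exact step n
  · obtain ⟨n, rfl⟩ := Nat.exists_eq_add_of_le' ht
    simp only [Nat.add_sub_cancel]
    induction n with
    | zero => simp
    | succ n ih =>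
      rw [pow_succ', mul_assoc]
      exact (step n).trans (mul_le_mul_of_nonneg_left (ih (Nat.le_add_left 1 n)) hα0.le)
end
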